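/- Let d ∈ ℕ, 1 < p ≤ 2, 0 < η ≤ θ ≤ 2 and r > 1/p + 1/η − 1. Then σ_m(S^r_{p,θ}B)_{A_η} ≍ m^{−(r + 1 − 1/p − 1/η)} · (log* m)^{(d−1)(r + 1 − 1/p − 1/θ)}. -/

import Mathlib

open MeasureTheory Real ENNReal

noncomputable section

namespace Paper

/-- The fundamental domain `[0,1)^d` of the `d`-dimensional torus `𝕋^d`. -/
def cube (d : ℕ) : Set (Fin d → ℝ) := Set.univ.pi fun _ => Set.Ico (0:ℝ) 1

/-- The trigonometric character `x ↦ e^{2π i k·x}`. -/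
def expk (d : ℕ) (k : Fin d → ℤ) (x : Fin d → ℝ) : ℂ :=
  Complex.exp (((2 * Real.pi * ∑ i, (k i : ℝ) * x i : ℝ) : ℂ) * Complex.I)

/-- Fourier coefficient `f̂(k) = ∫_{[0,1)^d} f(x) e^{-2π i k·x} dx`. -/
def fCoeff (d : ℕ) (f : (Fin d → ℝ) → ℂ) (k : Fin d → ℤ) : ℂ :=
  ∫ x in cube d, f x * expk d (-k) x

/-- The `L_q` (quasi-)norm on the torus, `q ∈ (0,∞]`, valued in `ℝ≥0∞`
(for `q = ∞` this is the essential supremum). -/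
def LqNorm (d : ℕ) (q : ℝ≥0∞) (f : (Fin d → ℝ) → ℂ) : ℝ≥0∞ :=
  eLpNorm f q (volume.restrict (cube d))

/-- The weight `∏_{i=1}^d (1+|k_i|)`. -/
def wt (d : ℕ) (k : Fin d → ℤ) : ℝ := ∏ i, (1 + |(k i : ℝ)|)

/-- The weighted Wiener (quasi-)norm `‖f‖_{S^r_θ A}`
(with the sup modification for `θ = ∞`); `A_θ` corresponds to `r = 0`,
the Wiener algebra `A` to `r = 0`, `θ = 1`. -/
def wienerNorm (d : ℕ) (r : ℝ) (θ : ℝ≥0∞) (f : (Fin d → ℝ) → ℂ) : ℝ≥0∞ :=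
  if θ = ∞ then ⨆ k : Fin d → ℤ, ENNReal.ofReal (wt d k ^ r) * (‖fCoeff d f k‖₊ : ℝ≥0∞)
  else (∑' k : Fin d → ℤ,
      (ENNReal.ofReal (wt d k ^ r) * (‖fCoeff d f k‖₊ : ℝ≥0∞)) ^ θ.toReal) ^ (1 / θ.toReal)

/-- Trigonometric polynomials with at most `m` terms. -/
def trigPoly (d m : ℕ) : Set ((Fin d → ℝ) → ℂ) :=
  {s | ∃ (Λ : Finset (Fin d → ℤ)) (a : (Fin d → ℤ) → ℂ),
    Λ.card ≤ m ∧ s = fun x => ∑ k ∈ Λ, a k * expk d k x}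

/-- Best `m`-term trigonometric approximation error of `f`, error measured by `X`. -/
def sigmaF (d m : ℕ) (X : ((Fin d → ℝ) → ℂ) → ℝ≥0∞) (f : (Fin d → ℝ) → ℂ) : ℝ≥0∞ :=
  ⨅ s ∈ trigPoly d m, X (f - s)

/-- The unit ball of the space (inside `L₁(𝕋^d)`) with (quasi-)norm `N`. -/
def unitBall (d : ℕ) (N : ((Fin d → ℝ) → ℂ) → ℝ≥0∞) : Set ((Fin d → ℝ) → ℂ) :=
  {f | IntegrableOn f (cube d) ∧ N f ≤ 1}

/-- Best `m`-term trigonometric width of the unit ball of `N`, error measured by `X`. -/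
def sigmaClass (d m : ℕ) (N X : ((Fin d → ℝ) → ℂ) → ℝ≥0∞) : ℝ≥0∞ :=
  ⨆ f ∈ unitBall d N, sigmaF d m X f

/-- `log*(m) = max (log₂ m) 1`. -/
def logStar (m : ℕ) : ℝ := max (Real.logb 2 m) 1

/-- Two-sided asymptotic equivalence `a_m ≍ b_m`. -/
def IsAsympEquiv (a : ℕ → ℝ≥0∞) (b : ℕ → ℝ) : Prop :=
  ∃ c C : ℝ, 0 < c ∧ 0 < C ∧ ∃ m₀ : ℕ, ∀ m : ℕ, m₀ ≤ m →
    ENNReal.ofReal (c * b m) ≤ a m ∧ a m ≤ ENNReal.ofReal (C * b m)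

/-- One-sided asymptotic bound `a_m ≲ b_m`. -/
def IsAsympLe (a : ℕ → ℝ≥0∞) (b : ℕ → ℝ) : Prop :=
  ∃ C : ℝ, 0 < C ∧ ∃ m₀ : ℕ, ∀ m : ℕ, m₀ ≤ m → a m ≤ ENNReal.ofReal (C * b m)

/-- Dyadic block `I_0 = {0}`, `I_n = {k : 2^{n-1} ≤ |k| < 2^n}` for `n ≥ 1`. -/
def blockF (n : ℕ) : Finset ℤ :=
  (Finset.Icc (-(2^n : ℤ)) (2^n)).filter fun k =>
    (n = 0 ∧ k = 0) ∨ (n ≠ 0 ∧ 2^(n-1) ≤ |k| ∧ |k| < 2^n)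

/-- The dyadic block projection `∑_{k ∈ I_j} f̂(k) e^{2π i k·x}`. -/
def blockProj (d : ℕ) (f : (Fin d → ℝ) → ℂ) (j : Fin d → ℕ) : (Fin d → ℝ) → ℂ :=
  fun x => ∑ k ∈ Fintype.piFinset (fun i => blockF (j i)), fCoeff d f k * expk d k x

/-- The mixed-smoothness Besov (quasi-)norm `‖f‖_{S^s_{p,θ}B}`
(with the sup modification for `θ = ∞`). -/
def besovNorm (d : ℕ) (s : ℝ) (p θ : ℝ≥0∞) (f : (Fin d → ℝ) → ℂ) : ℝ≥0∞ :=
  if θ = ∞ then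
    ⨆ j : Fin d → ℕ,
      ENNReal.ofReal ((2:ℝ) ^ (((∑ i, j i : ℕ) : ℝ) * s)) * LqNorm d p (blockProj d f j)
  else
    (∑' j : Fin d → ℕ,
      (ENNReal.ofReal ((2:ℝ) ^ (((∑ i, j i : ℕ) : ℝ) * s)) * LqNorm d p (blockProj d f j))
        ^ θ.toReal) ^ (1 / θ.toReal)

/-- The mixed-smoothness Sobolev norm `‖f‖_{S^s_p W}` (Littlewood–Paley form),
with `S^0_p W := L_p`. -/
def sobolevNorm (d : ℕ) (s : ℝ) (p : ℝ≥0∞) (f : (Fin d → ℝ) → ℂ) : ℝ≥0∞ :=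
  if s = 0 then LqNorm d p f
  else
    (∫⁻ x in cube d,
      ((∑' j : Fin d → ℕ,
        (ENNReal.ofReal ((2:ℝ) ^ (((∑ i, j i : ℕ) : ℝ) * s)) *
          (‖blockProj d f j x‖₊ : ℝ≥0∞)) ^ (2:ℕ)) ^ ((1:ℝ)/2)) ^ p.toReal) ^ (1 / p.toReal)

/-- Trigonometric polynomials with frequencies in `[-M,M]^d`. -/
def boxPoly (d M : ℕ) : Set ((Fin d → ℝ) → ℂ) :=
  {s | ∃ (Λ : Finset (Fin d → ℤ)) (a : (Fin d → ℤ) → ℂ),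
    (∀ k ∈ Λ, ∀ i, |k i| ≤ (M : ℤ)) ∧ s = fun x => ∑ k ∈ Λ, a k * expk d k x}

/-- Error of best approximation by trigonometric polynomials with
frequencies in `[-M,M]^d`, measured in `L_∞`. -/
def EBox (d M : ℕ) (f : (Fin d → ℝ) → ℂ) : ℝ≥0∞ :=
  ⨅ g ∈ boxPoly d M, LqNorm d ∞ (f - g)

/-- The `m`-th (non-linear) sampling width of the class of continuous functions
in the unit ball of `N`, error measured in `L_q`. -/
def samplingWidth (d m : ℕ) (N : ((Fin d → ℝ) → ℂ) → ℝ≥0∞) (q : ℝ≥0∞) : ℝ≥0∞ :=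
  ⨅ (t : Fin m → (Fin d → ℝ)) (_ : ∀ i, t i ∈ cube d)
    (R : (Fin m → ℂ) → ((Fin d → ℝ) → ℂ)),
    ⨆ f ∈ {f : (Fin d → ℝ) → ℂ | Continuous f ∧ N f ≤ 1},
      LqNorm d q (f - R fun i => f (t i))

/-! ### Characters and Fourier coefficients of trigonometric polynomials -/

lemma expk_add (d : ℕ) (k l : Fin d → ℤ) (x : Fin d → ℝ) :
    expk d (k + l) x = expk d k x * expk d l x := by
  unfold expk
  rw [← Complex.exp_add]
  congr 1
  simp only [Pi.add_apply, Int.cast_add, add_mul, Finset.sum_add_distrib, mul_add]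
  push_cast
  ring

lemma norm_expk (d : ℕ) (k : Fin d → ℤ) (x : Fin d → ℝ) : ‖expk d k x‖ = 1 :=
  Complex.norm_exp_ofReal_mul_I _

lemma conj_expk (d : ℕ) (k : Fin d → ℤ) (x : Fin d → ℝ) :
    (starRingEnd ℂ) (expk d k x) = expk d (-k) x := by
  unfold expk
  rw [← Complex.exp_conj]
  congr 1
  rw [map_mul, Complex.conj_ofReal, Complex.conj_I]
  simp

lemma continuous_expk (d : ℕ) (k : Fin d → ℤ) : Continuous (expk d k) := by
  unfold expk
  fun_prop

lemma continuous_trigPoly (d : ℕ) (S : Finset (Fin d → ℤ)) (a : (Fin d → ℤ) → ℂ) :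
    Continuous fun x => ∑ k ∈ S, a k * expk d k x :=
  continuous_finsetSum _ fun k _ => continuous_const.mul (continuous_expk d k)

instance isProbabilityMeasure_cube (d : ℕ) :
    IsProbabilityMeasure (volume.restrict (cube d)) := by
  constructor
  rw [Measure.restrict_apply_univ, cube, Real.volume_pi_Ico]
  simp

lemma norm_trigPoly_le (d : ℕ) (S : Finset (Fin d → ℤ)) (a : (Fin d → ℤ) → ℂ)
    (x : Fin d → ℝ) : ‖∑ k ∈ S, a k * expk d k x‖ ≤ ∑ k ∈ S, ‖a k‖ :=
  (norm_sum_le _ _).trans (Finset.sum_le_sum fun k _ => by rw [norm_mul, norm_expk, mul_one])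

lemma memLp_trigPoly (d : ℕ) (q : ℝ≥0∞) (S : Finset (Fin d → ℤ)) (a : (Fin d → ℤ) → ℂ) :
    MemLp (fun x => ∑ k ∈ S, a k * expk d k x) q (volume.restrict (cube d)) :=
  MemLp.of_bound (continuous_trigPoly d S a).aestronglyMeasurable (∑ k ∈ S, ‖a k‖)
    (ae_of_all _ (norm_trigPoly_le d S a))

lemma integrable_trigPoly (d : ℕ) (S : Finset (Fin d → ℤ)) (a : (Fin d → ℤ) → ℂ) :
    IntegrableOn (fun x => ∑ k ∈ S, a k * expk d k x) (cube d) :=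
  memLp_one_iff_integrable.1 (memLp_trigPoly d 1 S a)

lemma integrable_expk (d : ℕ) (k : Fin d → ℤ) : IntegrableOn (expk d k) (cube d) := by
  simpa using integrable_trigPoly d {k} 1

lemma setIntegral_exp_two_pi (n : ℤ) :
    ∫ x in Set.Ico (0:ℝ) 1, Complex.exp (((2 * Real.pi * (n * x) : ℝ) : ℂ) * Complex.I)
      = if n = 0 then 1 else 0 := by
  rw [integral_Ico_eq_integral_Ioc, ← intervalIntegral.integral_of_le zero_le_one]
  split_ifs with h
  · simp [h]
  · have hc : (2 * Real.pi * n * Complex.I : ℂ) ≠ 0 := by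
      simp [h, Real.pi_ne_zero]
    have := integral_exp_mul_complex (a := 0) (b := 1) hc
    convert this using 1
    · congr 1
      ext x
      congr 1
      push_cast
      ring
    · have h1 : Complex.exp (2 * Real.pi * n * Complex.I) = 1 :=
        Complex.exp_eq_one_iff.2 ⟨n, by ring⟩
      simp [h1]

lemma integral_expk (d : ℕ) (k : Fin d → ℤ) :
    ∫ x in cube d, expk d k x = if k = 0 then 1 else 0 := by
  have h : expk d k = fun x => ∏ i,
      Complex.exp (((2 * Real.pi * (k i * x i) : ℝ) : ℂ) * Complex.I) := by
    ext x
    rw [← Complex.exp_sum, expk]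
    congr 1
    rw [Finset.mul_sum]
    push_cast
    rw [Finset.sum_mul]
  rw [h, cube, volume_pi, Measure.restrict_pi_pi,
    integral_fintype_prod_eq_prod (𝕜 := ℂ)
      (fun i (x : ℝ) => Complex.exp (((2 * Real.pi * (k i * x) : ℝ) : ℂ) * Complex.I))]
  simp_rw [setIntegral_exp_two_pi]
  rw [Finset.prod_ite_zero]
  simp [funext_iff]

lemma fCoeff_trigPoly (d : ℕ) (S : Finset (Fin d → ℤ)) (a : (Fin d → ℤ) → ℂ)
    (l : Fin d → ℤ) :
    fCoeff d (fun x => ∑ k ∈ S, a k * expk d k x) l = if l ∈ S then a l else 0 := by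
  unfold fCoeff
  have h : ∀ x, (∑ k ∈ S, a k * expk d k x) * expk d (-l) x
      = ∑ k ∈ S, a k * expk d (k + -l) x := fun x => by
    rw [Finset.sum_mul]
    exact Finset.sum_congr rfl fun k _ => by rw [expk_add]; ring
  simp_rw [h]
  rw [integral_finsetSum _ fun k _ => (integrable_expk d _).const_mul _]
  simp_rw [integral_const_mul, integral_expk, add_neg_eq_zero]
  simp

lemma fCoeff_sub (d : ℕ) {f g : (Fin d → ℝ) → ℂ} (hf : IntegrableOn f (cube d))
    (hg : IntegrableOn g (cube d)) (k : Fin d → ℤ) :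
    fCoeff d (f - g) k = fCoeff d f k - fCoeff d g k := by
  unfold fCoeff
  have hb : ∀ᵐ x ∂(volume.restrict (cube d)), ‖expk d (-k) x‖ ≤ 1 :=
    ae_of_all _ fun x => (norm_expk d (-k) x).le
  have hm := (continuous_expk d (-k)).aestronglyMeasurable (μ := volume.restrict (cube d))
  rw [← integral_sub (hf.mul_bdd hm hb) (hg.mul_bdd hm hb)]
  simp [sub_mul]

lemma integral_norm_sq_trigPoly (d : ℕ) (S : Finset (Fin d → ℤ)) (a : (Fin d → ℤ) → ℂ) :
    ∫ x in cube d, ‖∑ k ∈ S, a k * expk d k x‖ ^ 2 = ∑ k ∈ S, ‖a k‖ ^ 2 := by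
  have h : ∀ x, ((‖∑ k ∈ S, a k * expk d k x‖ ^ 2 : ℝ) : ℂ)
      = ∑ l ∈ S, (starRingEnd ℂ) (a l) *
        ((∑ k ∈ S, a k * expk d k x) * expk d (-l) x) := fun x => by
    push_cast
    rw [← Complex.mul_conj', map_sum, Finset.mul_sum]
    refine Finset.sum_congr rfl fun l _ => ?_
    rw [map_mul, conj_expk]
    ring
  have hi : ∀ l, Integrable (fun x => (∑ k ∈ S, a k * expk d k x) * expk d (-l) x)
      (volume.restrict (cube d)) := fun l =>
    Integrable.mul_bdd (integrable_trigPoly d S a) (continuous_expk d (-l)).aestronglyMeasurable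
      (ae_of_all _ fun x => (norm_expk d (-l) x).le)
  have := calc
    ((∫ x in cube d, ‖∑ k ∈ S, a k * expk d k x‖ ^ 2 : ℝ) : ℂ)
      = ∫ x in cube d, ((‖∑ k ∈ S, a k * expk d k x‖ ^ 2 : ℝ) : ℂ) := integral_ofReal.symm
    _ = ∑ l ∈ S, (starRingEnd ℂ) (a l) *
        fCoeff d (fun x => ∑ k ∈ S, a k * expk d k x) l := by
      simp_rw [h]
      rw [integral_finsetSum _ fun l _ => (hi l).const_mul _]
      simp_rw [integral_const_mul]
      rfl
    _ = ((∑ k ∈ S, ‖a k‖ ^ 2 : ℝ) : ℂ) := by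
      push_cast
      refine Finset.sum_congr rfl fun l hl => ?_
      rw [fCoeff_trigPoly, if_pos hl, Complex.conj_mul']
  exact_mod_cast this

/-! ### A Nikol'skii type inequality -/

lemma sqrt_sum_sq_le_integral (d : ℕ) (S : Finset (Fin d → ℤ)) (a : (Fin d → ℤ) → ℂ)
    {P : ℝ} (hP : 0 < P) (hP2 : P ≤ 2) :
    (∑ k ∈ S, ‖a k‖ ^ 2) ^ (1 / 2 : ℝ) ≤ (S.card : ℝ) ^ (1 / P - 1 / 2) *
      (∫ x in cube d, ‖∑ k ∈ S, a k * expk d k x‖ ^ P) ^ (1 / P) := by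
  set A := ∑ k ∈ S, ‖a k‖ ^ 2 with hA
  set I := ∫ x in cube d, ‖∑ k ∈ S, a k * expk d k x‖ ^ P with hI
  have hI0 : 0 ≤ I := integral_nonneg fun x => by positivity
  have hA0 : 0 ≤ A := Finset.sum_nonneg fun k _ => by positivity
  rcases hA0.eq_or_lt with h0 | hApos
  · rw [← h0, Real.zero_rpow (by norm_num)]
    positivity
  have hPow : ∀ Q : ℝ, 0 < Q →
      Integrable (fun x => ‖∑ k ∈ S, a k * expk d k x‖ ^ Q) (volume.restrict (cube d)) := by
    intro Q hQ
    have := (memLp_trigPoly d (ENNReal.ofReal Q) S a).integrable_norm_rpow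
      (by simpa using hQ) ENNReal.ofReal_ne_top
    rwa [ENNReal.toReal_ofReal hQ.le] at this
  have key : A ≤ (S.card * A) ^ ((2 - P) / 2) * I := by
    rw [hA, ← integral_norm_sq_trigPoly, hI, ← integral_const_mul]
    refine integral_mono (by simpa using hPow 2 two_pos) ((hPow P hP).const_mul _) fun x => ?_
    have h1 : ‖∑ k ∈ S, a k * expk d k x‖ ≤ (S.card * A) ^ (1 / 2 : ℝ) := by
      refine (norm_trigPoly_le d S a x).trans ?_
      rw [← Real.sqrt_eq_rpow]
      exact Real.le_sqrt_of_sq_le sq_sum_le_card_mul_sum_sq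
    have h2 : ‖∑ k ∈ S, a k * expk d k x‖ ^ (2 - P) ≤ (S.card * A) ^ ((2 - P) / 2) := by
      refine (Real.rpow_le_rpow (norm_nonneg _) h1 (by linarith)).trans_eq ?_
      rw [← Real.rpow_mul (by positivity)]
      congr 1
      ring
    calc ‖∑ k ∈ S, a k * expk d k x‖ ^ 2
        = ‖∑ k ∈ S, a k * expk d k x‖ ^ (2 - P) * ‖∑ k ∈ S, a k * expk d k x‖ ^ P := by
          rw [← Real.rpow_add_of_nonneg (norm_nonneg _) (by linarith) hP.le]
          norm_num
      _ ≤ _ := by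
          rw [integral_norm_sq_trigPoly]
          gcongr
  have key2 : A ^ (P / 2) ≤ (S.card : ℝ) ^ ((2 - P) / 2) * I := by
    have h1 : A = A ^ ((2 - P) / 2) * A ^ (P / 2) := by
      rw [← Real.rpow_add hApos, show (2 - P) / 2 + P / 2 = 1 by ring, Real.rpow_one]
    rw [Real.mul_rpow (Nat.cast_nonneg _) hA0] at key
    have h3 : 0 < A ^ ((2 - P) / 2) := by positivity
    refine le_of_mul_le_mul_left ?_ h3
    rw [← h1]
    linarith
  calc A ^ (1 / 2 : ℝ) = (A ^ (P / 2)) ^ (1 / P) := by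
        rw [← Real.rpow_mul hA0]
        congr 1
        field_simp
    _ ≤ ((S.card : ℝ) ^ ((2 - P) / 2) * I) ^ (1 / P) := by
        gcongr
    _ = _ := by
        rw [Real.mul_rpow (by positivity) hI0, ← Real.rpow_mul (by positivity)]
        congr 2
        field_simp

lemma sum_rpow_le_sum_sq {ι : Type*} (S : Finset ι) (b : ι → ℝ) (hb : ∀ i, 0 ≤ b i)
    {H : ℝ} (hH : 0 < H) (hH2 : H ≤ 2) :
    ∑ i ∈ S, b i ^ H ≤
      ((S.card : ℝ) ^ (1 / H - 1 / 2) * (∑ i ∈ S, b i ^ 2) ^ (1 / 2 : ℝ)) ^ H := by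
  have hs : 0 ≤ ∑ i ∈ S, b i ^ 2 := Finset.sum_nonneg fun i _ => sq_nonneg _
  have h := Real.rpow_sum_le_const_mul_sum_rpow_of_nonneg S (f := fun i => b i ^ H)
    (p := 2 / H) (by rw [le_div_iff₀ hH]; linarith) fun i _ => Real.rpow_nonneg (hb i) _
  have h2 : ∀ i, (b i ^ H) ^ (2 / H) = b i ^ 2 := fun i => by
    rw [← Real.rpow_mul (hb i), mul_div_cancel₀ _ hH.ne']
    norm_num
  simp_rw [h2] at h
  have h0 : 0 ≤ ∑ i ∈ S, b i ^ H := Finset.sum_nonneg fun i _ => Real.rpow_nonneg (hb i) _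
  calc ∑ i ∈ S, b i ^ H = ((∑ i ∈ S, b i ^ H) ^ (2 / H)) ^ (H / 2) := by
        rw [← Real.rpow_mul h0]
        field_simp
        simp
    _ ≤ ((S.card : ℝ) ^ (2 / H - 1) * ∑ i ∈ S, b i ^ 2) ^ (H / 2) := by
        gcongr
    _ = _ := by
        rw [Real.mul_rpow (by positivity) hs, Real.mul_rpow (by positivity) (by positivity),
          ← Real.rpow_mul (by positivity), ← Real.rpow_mul (by positivity), ← Real.rpow_mul hs]
        congr 2 <;> field_simp

lemma LqNorm_trigPoly (d : ℕ) {p : ℝ≥0∞} (hp0 : p ≠ 0) (hp : p ≠ ∞)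
    (S : Finset (Fin d → ℤ)) (a : (Fin d → ℤ) → ℂ) :
    LqNorm d p (fun x => ∑ k ∈ S, a k * expk d k x) = ENNReal.ofReal
      ((∫ x in cube d, ‖∑ k ∈ S, a k * expk d k x‖ ^ p.toReal) ^ (1 / p.toReal)) := by
  rw [LqNorm, (memLp_trigPoly d p S a).eLpNorm_eq_integral_rpow_norm hp0 hp, one_div]

/-- The `ℓ_η` norm of the coefficients of a trigonometric polynomial with at most `N`
frequencies is controlled by its `L_p` norm. -/
lemma sum_coeff_rpow_le_LqNorm (d : ℕ) {p : ℝ≥0∞} (hp0 : p ≠ 0) (hp : p ≤ 2)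
    (S : Finset (Fin d → ℤ)) (a : (Fin d → ℤ) → ℂ) {H : ℝ} (hH : 0 < H) (hH2 : H ≤ 2)
    {N : ℝ} (hN : S.card ≤ N) :
    ∑ k ∈ S, (‖a k‖₊ : ℝ≥0∞) ^ H ≤ (ENNReal.ofReal (N ^ (1 / H + 1 / p.toReal - 1)) *
      LqNorm d p (fun x => ∑ k ∈ S, a k * expk d k x)) ^ H := by
  have hpt : p ≠ ∞ := ne_top_of_le_ne_top (by simp) hp
  have hP : 0 < p.toReal := ENNReal.toReal_pos hp0 hpt
  have hP2 : p.toReal ≤ 2 := ENNReal.toReal_le_of_le_ofReal (by norm_num) (by simpa using hp)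
  have hN0 : 0 ≤ N := (Nat.cast_nonneg _).trans hN
  rw [LqNorm_trigPoly d hp0 hpt, ← ENNReal.ofReal_mul (by positivity),
    ENNReal.ofReal_rpow_of_nonneg (by positivity) hH.le]
  have e : ∀ k, (‖a k‖₊ : ℝ≥0∞) ^ H = ENNReal.ofReal (‖a k‖ ^ H) := fun k => by
    rw [← ENNReal.ofReal_rpow_of_nonneg (norm_nonneg _) hH.le, ofReal_norm]
    rfl
  simp_rw [e]
  rw [← ENNReal.ofReal_sum_of_nonneg fun k _ => by positivity]
  refine ENNReal.ofReal_le_ofReal ((sum_rpow_le_sum_sq S (fun k => ‖a k‖)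
    (fun k => norm_nonneg _) hH hH2).trans ?_)
  have hI0 : 0 ≤ ∫ x in cube d, ‖∑ k ∈ S, a k * expk d k x‖ ^ p.toReal :=
    integral_nonneg fun x => by positivity
  have h1 : 0 ≤ 1 / H - 1 / 2 := sub_nonneg.2 (one_div_le_one_div_of_le hH hH2)
  have h2 : 0 ≤ 1 / p.toReal - 1 / 2 := sub_nonneg.2 (one_div_le_one_div_of_le hP hP2)
  refine Real.rpow_le_rpow (by positivity) ?_ hH.le
  calc (S.card : ℝ) ^ (1 / H - 1 / 2) * (∑ i ∈ S, ‖a i‖ ^ 2) ^ (1 / 2 : ℝ)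
      ≤ N ^ (1 / H - 1 / 2) * (N ^ (1 / p.toReal - 1 / 2) *
        (∫ x in cube d, ‖∑ k ∈ S, a k * expk d k x‖ ^ p.toReal) ^ (1 / p.toReal)) := by
        refine mul_le_mul (by gcongr) ((sqrt_sum_sq_le_integral d S a hP hP2).trans ?_)
          (by positivity) (by positivity)
        gcongr
    _ = _ := by
        rw [← mul_assoc, ← Real.rpow_add_of_nonneg hN0 h1 h2]
        congr 2
        ring

/-! ### Dyadic blocks -/

lemma mem_blockF (n : ℕ) (k : ℤ) : k ∈ blockF n ↔ Nat.size k.natAbs = n := by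
  have hc : ((2:ℤ) ^ n) = ((2 ^ n : ℕ) : ℤ) := by push_cast; rfl
  rcases n with _ | n
  · simp only [blockF, Finset.mem_filter, Finset.mem_Icc, Nat.size_eq_zero]
    simp
    omega
  · have hc' : ((2:ℤ) ^ n) = ((2 ^ n : ℕ) : ℤ) := by push_cast; rfl
    have h1 : Nat.size k.natAbs = n + 1 ↔ 2 ^ n ≤ k.natAbs ∧ k.natAbs < 2 ^ (n + 1) := by
      rw [← Nat.lt_size, ← Nat.size_le]
      omega
    rw [h1]
    simp only [blockF, Finset.mem_filter, Finset.mem_Icc, Nat.add_sub_cancel, hc, hc', Int.abs_eq_natAbs]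
    omega

lemma card_blockF_le (n : ℕ) : (blockF n).card ≤ 2 ^ n := by
  rcases n with _ | n
  · have : blockF 0 ⊆ {0} := fun k hk => by
      rw [mem_blockF, Nat.size_eq_zero] at hk
      simpa using hk
    simpa using Finset.card_le_card this
  · have : blockF (n + 1) ⊆ Finset.Ico (2 ^ n) (2 ^ (n + 1)) ∪
        Finset.Ioc (-2 ^ (n + 1)) (-2 ^ n) := fun k hk => by
      simp only [blockF, Finset.mem_filter, Nat.add_sub_cancel, Int.abs_eq_natAbs] at hk
      simp only [Finset.mem_union, Finset.mem_Ico, Finset.mem_Ioc]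
      omega
    refine (Finset.card_le_card this).trans ((Finset.card_union_le _ _).trans ?_)
    simp only [Int.card_Ico, Int.card_Ioc]
    have hc : ((2:ℤ) ^ n) = ((2 ^ n : ℕ) : ℤ) := by push_cast; rfl
    rw [pow_succ, pow_succ, hc]
    omega

/-- The multi-index of the dyadic block containing a frequency. -/
def blockIndex (d : ℕ) (k : Fin d → ℤ) : Fin d → ℕ := fun i => Nat.size (k i).natAbs

lemma mem_piFinset_blockF (d : ℕ) (j : Fin d → ℕ) (k : Fin d → ℤ) :
    k ∈ Fintype.piFinset (fun i => blockF (j i)) ↔ blockIndex d k = j := by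
  simp [Fintype.mem_piFinset, mem_blockF, blockIndex, funext_iff]

lemma card_piFinset_blockF_le (d : ℕ) (j : Fin d → ℕ) :
    (Fintype.piFinset (fun i => blockF (j i))).card ≤ 2 ^ (∑ i, j i) := by
  rw [Fintype.card_piFinset, ← Finset.prod_pow_eq_pow_sum]
  exact Finset.prod_le_prod' fun i _ => card_blockF_le _

lemma tsum_eq_tsum_sum_fiber {α β : Type*} (g : α → β) (S : β → Finset α)
    (hS : ∀ a b, a ∈ S b ↔ g a = b) (F : α → ℝ≥0∞) :
    ∑' a, F a = ∑' b, ∑ a ∈ S b, F a := by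
  classical
  have h1 : ∀ a, F a = ∑' b, if b = g a then F a else 0 := fun a => by rw [tsum_ite_eq]
  rw [tsum_congr h1, ENNReal.tsum_comm]
  refine tsum_congr fun b => ?_
  rw [tsum_eq_sum (s := S b) fun a ha => if_neg fun h => ha ((hS a b).2 h.symm)]
  exact Finset.sum_congr rfl fun a ha => if_pos ((hS a b).1 ha).symm

/-! ### Counting multi-indices of given length -/

lemma sum_eq_iff_mem_antidiagonalTuple (d : ℕ) (j : Fin d → ℕ) (n : ℕ) :
    j ∈ Finset.Nat.antidiagonalTuple d n ↔ ∑ i, j i = n :=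
  Finset.Nat.mem_antidiagonalTuple

lemma card_antidiagonalTuple_le (e n : ℕ) :
    (Finset.Nat.antidiagonalTuple (e + 1) n).card ≤ (n + 1) ^ e := by
  have h : (Finset.Nat.antidiagonalTuple (e + 1) n).card ≤
      (Fintype.piFinset fun _ : Fin e => Finset.range (n + 1)).card := by
    refine Finset.card_le_card_of_injOn (fun t i => t i.succ) ?_ ?_
    · intro t ht
      simp only [Finset.mem_coe, sum_eq_iff_mem_antidiagonalTuple] at ht
      simp only [Finset.mem_coe, Fintype.mem_piFinset, Finset.mem_range]
      intro i
      have := Finset.single_le_sum (f := t) (fun _ _ => Nat.zero_le _) (Finset.mem_univ i.succ)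
      omega
    · intro t ht u hu htu
      simp only [Finset.mem_coe, sum_eq_iff_mem_antidiagonalTuple, Fin.sum_univ_succ] at ht hu
      have h : ∀ i : Fin e, t i.succ = u i.succ := fun i => congrFun htu i
      simp only [h] at ht
      ext i
      refine Fin.cases ?_ h i
      omega
  simpa using h

lemma le_card_antidiagonalTuple (e n : ℕ) :
    (n + 1) ^ e ≤ (e + 1) ^ e * (Finset.Nat.antidiagonalTuple (e + 1) n).card := by
  have h : (Fintype.piFinset fun _ : Fin e => Finset.range (n / (e + 1) + 1)).card ≤
      (Finset.Nat.antidiagonalTuple (e + 1) n).card := by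
    refine Finset.card_le_card_of_injOn
      (fun t => (Fin.cons (n - ∑ i, t i) t : Fin (e + 1) → ℕ)) ?_ ?_
    · intro t ht
      simp only [Finset.mem_coe, Fintype.mem_piFinset, Finset.mem_range] at ht
      simp only [Finset.mem_coe, sum_eq_iff_mem_antidiagonalTuple, Fin.sum_univ_succ,
        Fin.cons_zero, Fin.cons_succ]
      have h1 : ∑ i, t i ≤ ∑ _i : Fin e, n / (e + 1) :=
        Finset.sum_le_sum fun i _ => Nat.lt_succ_iff.1 (ht i)
      have h2 : e * (n / (e + 1)) ≤ n :=
        (Nat.mul_le_mul_right _ (Nat.le_succ e)).trans (Nat.mul_div_le n (e + 1))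
      simp only [Finset.sum_const, Finset.card_univ, Fintype.card_fin, smul_eq_mul] at h1
      omega
    · intro t _ u _ htu
      exact (Fin.cons_injective2 htu).2
  have h2 : n + 1 ≤ (e + 1) * (n / (e + 1) + 1) := Nat.lt_mul_div_succ n (Nat.succ_pos e)
  calc (n + 1) ^ e ≤ ((e + 1) * (n / (e + 1) + 1)) ^ e := Nat.pow_le_pow_left h2 e
    _ = (e + 1) ^ e * (n / (e + 1) + 1) ^ e := mul_pow _ _ _
    _ ≤ _ := Nat.mul_le_mul_left _ (by simpa using h)

/-! ### The upper bound -/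

lemma wienerNorm_zero (d : ℕ) {η : ℝ≥0∞} (hη : η ≠ ∞) (f : (Fin d → ℝ) → ℂ) :
    wienerNorm d 0 η f
      = (∑' k : Fin d → ℤ, (‖fCoeff d f k‖₊ : ℝ≥0∞) ^ η.toReal) ^ (1 / η.toReal) := by
  simp [wienerNorm, hη]

lemma rpow_le_add_mul_rpow (b : ℝ≥0∞) {τ H T : ℝ} (hτ : 0 < τ) (hH : 0 < H) (hHT : H ≤ T) :
    b ^ H ≤ ENNReal.ofReal (τ ^ H) + ENNReal.ofReal (τ ^ (H - T)) * b ^ T := by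
  rw [← ENNReal.ofReal_rpow_of_pos hτ, ← ENNReal.ofReal_rpow_of_pos hτ]
  rcases le_total b (ENNReal.ofReal τ) with h | h
  · exact (ENNReal.rpow_le_rpow h hH.le).trans le_self_add
  · refine le_trans ?_ le_add_self
    have hτ0 : ENNReal.ofReal τ ≠ 0 := by simpa using hτ
    have hb0 : b ≠ 0 := fun hb => hτ0 (le_antisymm (hb ▸ h) zero_le)
    rcases eq_or_ne b ∞ with rfl | hb
    · rw [ENNReal.top_rpow_of_pos (hH.trans_le hHT), ENNReal.mul_top]
      · exact le_top
      · simp [ENNReal.ofReal_rpow_of_pos hτ, Real.rpow_pos_of_pos hτ]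
    · calc b ^ H = b ^ (H - T) * b ^ T := by
            rw [← ENNReal.rpow_add _ _ hb0 hb]
            congr 1
            ring
        _ ≤ _ := by
            rw [← neg_sub T H, ENNReal.rpow_neg, ENNReal.rpow_neg]
            gcongr ?_⁻¹ * _
            exact ENNReal.rpow_le_rpow h (by linarith)

/-- The frequencies of the dyadic hyperbolic cross of level `L`. -/
def hyperbolicCross (d L : ℕ) : Finset (Fin d → ℤ) :=
  (Finset.range (L + 1)).biUnion fun n => (Finset.Nat.antidiagonalTuple d n).biUnion fun j =>
    Fintype.piFinset fun i => blockF (j i)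

lemma mem_hyperbolicCross (d L : ℕ) (k : Fin d → ℤ) :
    k ∈ hyperbolicCross d L ↔ ∑ i, blockIndex d k i ≤ L := by
  simp only [hyperbolicCross, Finset.mem_biUnion, Finset.mem_range,
    sum_eq_iff_mem_antidiagonalTuple, mem_piFinset_blockF]
  constructor
  · rintro ⟨n, hn, j, rfl, rfl⟩
    omega
  · exact fun h => ⟨_, Nat.lt_succ_iff.2 h, _, rfl, rfl⟩

lemma card_hyperbolicCross_le (e L : ℕ) :
    (hyperbolicCross (e + 1) L).card ≤ 2 ^ (L + 1) * (L + 1) ^ e := by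
  calc (hyperbolicCross (e + 1) L).card
      ≤ ∑ n ∈ Finset.range (L + 1), ∑ j ∈ Finset.Nat.antidiagonalTuple (e + 1) n,
          (Fintype.piFinset fun i => blockF (j i)).card :=
        Finset.card_biUnion_le.trans (Finset.sum_le_sum fun n _ => Finset.card_biUnion_le)
    _ ≤ ∑ n ∈ Finset.range (L + 1), ∑ j ∈ Finset.Nat.antidiagonalTuple (e + 1) n, 2 ^ n := by
        refine Finset.sum_le_sum fun n _ => Finset.sum_le_sum fun j hj => ?_
        rw [← (sum_eq_iff_mem_antidiagonalTuple _ _ _).1 hj]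
        exact card_piFinset_blockF_le _ _
    _ ≤ ∑ n ∈ Finset.range (L + 1), 2 ^ n * (L + 1) ^ e := by
        refine Finset.sum_le_sum fun n hn => ?_
        rw [Finset.sum_const, smul_eq_mul, mul_comm]
        refine Nat.mul_le_mul_left _ ((card_antidiagonalTuple_le e n).trans ?_)
        exact Nat.pow_le_pow_left (by simpa using Finset.mem_range.1 hn) e
    _ ≤ _ := by
        rw [← Finset.sum_mul]
        exact Nat.mul_le_mul_right _ (Nat.geomSum_lt le_rfl (by simp)).le

/-- Tail estimate for the weights `2^{-β|j|₁}` outside of a hyperbolic cross. -/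
lemma exists_tsum_tail_le (e : ℕ) {β : ℝ} (hβ : 0 < β) : ∃ K : ℝ, 0 ≤ K ∧ ∀ L : ℕ,
    ∑' j : Fin (e + 1) → ℕ, (if ∑ i, j i ≤ L then 0
      else ENNReal.ofReal ((2:ℝ) ^ (-β * ((∑ i, j i : ℕ) : ℝ))))
    ≤ ENNReal.ofReal (K * ((2:ℝ) ^ (-β * L) * ((L:ℝ) + 1) ^ e)) := by
  set u : ℕ → ℝ := fun i => ((i:ℝ) + 1) ^ e * (2:ℝ) ^ (-β * i) with hu
  have hu0 : ∀ i, 0 ≤ u i := fun i => by positivity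
  have hq : ∀ i : ℕ, (2:ℝ) ^ (-β * i) = ((2:ℝ) ^ (-β)) ^ i := fun i => by
    rw [Real.rpow_mul_natCast (by norm_num)]
  have hsum : Summable u := by
    have hlt : ‖(2:ℝ) ^ (-β)‖ < 1 := by
      rw [Real.norm_of_nonneg (by positivity)]
      exact Real.rpow_lt_one_of_one_lt_of_neg (by norm_num) (by linarith)
    have h := (summable_nat_add_iff (f := fun n : ℕ => (n:ℝ) ^ e * ((2:ℝ) ^ (-β)) ^ n) 1).2
      (summable_pow_mul_geometric_of_norm_lt_one e hlt)
    refine (h.mul_left ((2:ℝ) ^ β)).congr fun i => ?_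
    rw [hu]
    simp only [hq, pow_succ]
    push_cast
    rw [show (2:ℝ) ^ β * (((i:ℝ) + 1) ^ e * (((2:ℝ) ^ (-β)) ^ i * (2:ℝ) ^ (-β)))
      = ((i:ℝ) + 1) ^ e * ((2:ℝ) ^ (-β)) ^ i * ((2:ℝ) ^ β * (2:ℝ) ^ (-β)) by ring,
      ← Real.rpow_add (by norm_num)]
    simp
  refine ⟨∑' i, u i, tsum_nonneg hu0, fun L => ?_⟩
  rw [tsum_eq_tsum_sum_fiber (fun j : Fin (e + 1) → ℕ => ∑ i, j i)
    (Finset.Nat.antidiagonalTuple (e + 1)) fun j n => sum_eq_iff_mem_antidiagonalTuple _ _ _]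
  set G : ℕ → ℝ≥0∞ := fun n => if n ≤ L then 0
    else ENNReal.ofReal (((n:ℝ) + 1) ^ e * (2:ℝ) ^ (-β * n)) with hG
  have h1 : ∀ n, ∑ j ∈ Finset.Nat.antidiagonalTuple (e + 1) n, (if ∑ i, j i ≤ L then 0
      else ENNReal.ofReal ((2:ℝ) ^ (-β * ((∑ i, j i : ℕ) : ℝ)))) ≤ G n := fun n => by
    rw [Finset.sum_congr (g := fun _ => if n ≤ L then 0 else ENNReal.ofReal ((2:ℝ) ^ (-β * n)))
      rfl fun j hj => by rw [(sum_eq_iff_mem_antidiagonalTuple _ _ _).1 hj],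
      Finset.sum_const, nsmul_eq_mul, hG]
    dsimp only
    split_ifs
    · simp
    · rw [ENNReal.ofReal_mul (by positivity)]
      gcongr
      rw [← ENNReal.ofReal_natCast]
      exact ENNReal.ofReal_le_ofReal (by exact_mod_cast card_antidiagonalTuple_le e n)
  have h2 : ∑' n, G n = ∑' i, G (L + i) := by
    refine (Function.Injective.tsum_eq (add_right_injective L) fun n hn => ?_).symm
    rw [Function.mem_support] at hn
    rcases le_or_gt n L with h | h
    · exact absurd (if_pos h) hn
    · exact ⟨n - L, by simp only; omega⟩
  have h3 : ∀ i, G (L + i) ≤ ENNReal.ofReal ((2:ℝ) ^ (-β * L) * ((L:ℝ) + 1) ^ e * u i) := by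
    intro i
    rw [hG]
    dsimp only
    split_ifs
    · exact zero_le
    · refine ENNReal.ofReal_le_ofReal ?_
      rw [hu]
      dsimp only
      push_cast
      rw [mul_add, Real.rpow_add (by norm_num)]
      calc ((L:ℝ) + i + 1) ^ e * ((2:ℝ) ^ (-β * L) * (2:ℝ) ^ (-β * i))
          ≤ (((L:ℝ) + 1) * ((i:ℝ) + 1)) ^ e * ((2:ℝ) ^ (-β * L) * (2:ℝ) ^ (-β * i)) := by
            gcongr
            nlinarith [(Nat.cast_nonneg L : (0:ℝ) ≤ L), (Nat.cast_nonneg i : (0:ℝ) ≤ i)]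
        _ = _ := by
            rw [mul_pow]
            ring
  calc _ ≤ ∑' n, G n := ENNReal.tsum_le_tsum h1
    _ ≤ ∑' i, ENNReal.ofReal ((2:ℝ) ^ (-β * L) * ((L:ℝ) + 1) ^ e * u i) :=
        h2 ▸ ENNReal.tsum_le_tsum h3
    _ = _ := by
        rw [← ENNReal.ofReal_tsum_of_nonneg (fun i => mul_nonneg (by positivity) (hu0 i))
          (hsum.mul_left _), tsum_mul_left, mul_comm]

lemma sum_block_coeff_le (d : ℕ) {p η : ℝ≥0∞} (hp0 : p ≠ 0) (hp2 : p ≤ 2) (hη : 0 < η)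
    (hη2 : η ≤ 2) (r : ℝ) (f : (Fin d → ℝ) → ℂ) (j : Fin d → ℕ) :
    ∑ k ∈ Fintype.piFinset (fun i => blockF (j i)), (‖fCoeff d f k‖₊ : ℝ≥0∞) ^ η.toReal
      ≤ ENNReal.ofReal ((2:ℝ) ^ (-((r + 1 - 1 / p.toReal - 1 / η.toReal) * η.toReal) *
          ((∑ i, j i : ℕ) : ℝ))) *
        (ENNReal.ofReal ((2:ℝ) ^ (((∑ i, j i : ℕ) : ℝ) * r)) *
          LqNorm d p (blockProj d f j)) ^ η.toReal := by
  have hηt : η ≠ ∞ := ne_top_of_le_ne_top (by simp) hη2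
  have hH : 0 < η.toReal := ENNReal.toReal_pos hη.ne' hηt
  have hH2 : η.toReal ≤ 2 := ENNReal.toReal_le_of_le_ofReal (by norm_num) (by simpa using hη2)
  refine (sum_coeff_rpow_le_LqNorm d hp0 hp2 _ (fCoeff d f) hH hH2
    (N := (2:ℝ) ^ (((∑ i, j i : ℕ) : ℝ))) ?_).trans_eq ?_
  · rw [Real.rpow_natCast]
    exact_mod_cast card_piFinset_blockF_le d j
  · rw [ENNReal.mul_rpow_of_nonneg _ _ hH.le, ENNReal.mul_rpow_of_nonneg _ _ hH.le, ← mul_assoc,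
      ENNReal.ofReal_rpow_of_pos (by positivity), ENNReal.ofReal_rpow_of_pos (by positivity),
      ← ENNReal.ofReal_mul (by positivity), ← Real.rpow_mul zero_le_two,
      ← Real.rpow_mul zero_le_two, ← Real.rpow_mul zero_le_two,
      ← Real.rpow_add (by norm_num)]
    congr 4
    ring

lemma tsum_besov_le_one (d : ℕ) (r : ℝ) (p : ℝ≥0∞) {θ : ℝ≥0∞} (hθ0 : θ ≠ 0) (hθ : θ ≠ ∞)
    {f : (Fin d → ℝ) → ℂ} (hf : besovNorm d r p θ f ≤ 1) :
    ∑' j : Fin d → ℕ, (ENNReal.ofReal ((2:ℝ) ^ (((∑ i, j i : ℕ) : ℝ) * r)) *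
      LqNorm d p (blockProj d f j)) ^ θ.toReal ≤ 1 := by
  have hT : 0 < θ.toReal := ENNReal.toReal_pos hθ0 hθ
  rw [besovNorm, if_neg hθ] at hf
  have := ENNReal.rpow_le_rpow hf hT.le
  rwa [← ENNReal.rpow_mul, one_div_mul_cancel hT.ne', ENNReal.rpow_one, ENNReal.one_rpow] at this

lemma exists_sigmaClass_le (e : ℕ) {p θ η : ℝ≥0∞} (hp0 : p ≠ 0) (hp2 : p ≤ 2)
    (hη : 0 < η) (hηθ : η ≤ θ) (hθ2 : θ ≤ 2) {r α : ℝ}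
    (hα : α = r + 1 - 1 / p.toReal - 1 / η.toReal) (hα0 : 0 < α) :
    ∃ C : ℝ, 0 < C ∧ ∀ L m : ℕ, 2 ^ (L + 1) * (L + 1) ^ e ≤ m →
      sigmaClass (e + 1) m (besovNorm (e + 1) r p θ) (wienerNorm (e + 1) 0 η) ≤
        ENNReal.ofReal (C * ((2:ℝ) ^ (-α * L) *
          ((L:ℝ) + 1) ^ (e * (1 / η.toReal - 1 / θ.toReal)))) := by
  have hθt : θ ≠ ∞ := ne_top_of_le_ne_top (by simp) hθ2
  have hηt : η ≠ ∞ := ne_top_of_le_ne_top hθt hηθ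
  have hH : 0 < η.toReal := ENNReal.toReal_pos hη.ne' hηt
  have hHT : η.toReal ≤ θ.toReal := ENNReal.toReal_mono hθt hηθ
  have hT : 0 < θ.toReal := hH.trans_le hHT
  have hθ0 : θ ≠ 0 := (hη.trans_le hηθ).ne'
  obtain ⟨K, hK0, hK⟩ := exists_tsum_tail_le e (mul_pos hα0 hH)
  refine ⟨(K + 1) ^ (1 / η.toReal), by positivity, fun L m hm => ?_⟩
  rw [sigmaClass]
  refine iSup₂_le fun f hf => ?_
  obtain ⟨hfi, hfb⟩ := hf
  have hfb' := tsum_besov_le_one _ r p hθ0 hθt hfb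
  set S := hyperbolicCross (e + 1) L with hS
  set s : (Fin (e + 1) → ℝ) → ℂ := fun x => ∑ k ∈ S, fCoeff (e + 1) f k * expk (e + 1) k x
    with hs
  refine (iInf₂_le s ⟨S, fCoeff (e + 1) f, (card_hyperbolicCross_le e L).trans hm, rfl⟩).trans ?_
  have hc : ∀ k, fCoeff (e + 1) (f - s) k
      = if ∑ i, blockIndex (e + 1) k i ≤ L then 0 else fCoeff (e + 1) f k := fun k => by
    rw [fCoeff_sub _ hfi (integrable_trigPoly _ _ _), fCoeff_trigPoly]
    simp only [hS, mem_hyperbolicCross]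
    split_ifs <;> simp
  set H := η.toReal with hHdef
  set T := θ.toReal
  set B : (Fin (e + 1) → ℕ) → ℝ≥0∞ := fun j =>
    ENNReal.ofReal ((2:ℝ) ^ (((∑ i, j i : ℕ) : ℝ) * r)) *
      LqNorm (e + 1) p (blockProj (e + 1) f j) with hB
  set w : (Fin (e + 1) → ℕ) → ℝ≥0∞ := fun j => if ∑ i, j i ≤ L then 0
      else ENNReal.ofReal ((2:ℝ) ^ (-(α * H) * ((∑ i, j i : ℕ) : ℝ))) with hw
  have hL1 : (0:ℝ) < (L:ℝ) + 1 := by positivity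
  set τ : ℝ := ((L:ℝ) + 1) ^ (-(e / T) : ℝ) with hτ
  have hτ0 : 0 < τ := by positivity
  have hτ1 : τ ^ H * ((L:ℝ) + 1) ^ e = ((L:ℝ) + 1) ^ (e * (1 - H / T)) := by
    rw [hτ, ← Real.rpow_mul hL1.le, ← Real.rpow_natCast, ← Real.rpow_add hL1]
    congr 1
    ring
  have hτ2 : τ ^ (H - T) = ((L:ℝ) + 1) ^ (e * (1 - H / T)) := by
    rw [hτ, ← Real.rpow_mul hL1.le]
    congr 1
    field_simp
    ring
  have hwle : ∀ j, w j ≤ ENNReal.ofReal ((2:ℝ) ^ (-(α * H) * L)) := fun j => by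
    rw [hw]
    dsimp only
    split_ifs with h
    · exact zero_le
    · refine ENNReal.ofReal_le_ofReal
        (Real.rpow_le_rpow_of_exponent_le (by norm_num) ?_)
      have : (L:ℝ) ≤ ((∑ i, j i : ℕ) : ℝ) := by exact_mod_cast (not_le.1 h).le
      nlinarith [mul_pos hα0 hH]
  have hblock : ∀ j, ∑ k ∈ Fintype.piFinset (fun i => blockF (j i)),
      (‖fCoeff (e + 1) (f - s) k‖₊ : ℝ≥0∞) ^ H ≤ w j * B j ^ H := fun j => by
    have hj : ∀ k ∈ Fintype.piFinset (fun i => blockF (j i)),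
        (‖fCoeff (e + 1) (f - s) k‖₊ : ℝ≥0∞) ^ H
          = if ∑ i, j i ≤ L then 0 else (‖fCoeff (e + 1) f k‖₊ : ℝ≥0∞) ^ H := fun k hk => by
      rw [hc, (mem_piFinset_blockF _ _ _).1 hk]
      split_ifs <;> simp [hH]
    rw [Finset.sum_congr rfl hj, hw]
    dsimp only
    split_ifs
    · simp
    · have := sum_block_coeff_le (e + 1) hp0 hp2 hη (hηθ.trans hθ2) r f j
      rwa [← hα] at this
  rw [wienerNorm_zero _ hηt, ← hHdef, tsum_eq_tsum_sum_fiber (blockIndex (e + 1))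
    (fun j => Fintype.piFinset fun i => blockF (j i)) fun k j => mem_piFinset_blockF _ _ _]
  have htotal := calc
    ∑' j : Fin (e + 1) → ℕ, ∑ k ∈ Fintype.piFinset (fun i => blockF (j i)),
        (‖fCoeff (e + 1) (f - s) k‖₊ : ℝ≥0∞) ^ H
      ≤ ∑' j, (w j * ENNReal.ofReal (τ ^ H) +
          ENNReal.ofReal ((2:ℝ) ^ (-(α * H) * L) * τ ^ (H - T)) * B j ^ T) := by
        refine ENNReal.tsum_le_tsum fun j => (hblock j).trans ?_
        refine (mul_le_mul_right (rpow_le_add_mul_rpow (B j) hτ0 hH hHT) _).trans ?_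
        rw [mul_add, ← mul_assoc, ENNReal.ofReal_mul (by positivity)]
        gcongr
        exact hwle j
    _ ≤ ENNReal.ofReal (K * ((2:ℝ) ^ (-(α * H) * L) * ((L:ℝ) + 1) ^ e)) * ENNReal.ofReal (τ ^ H)
        + ENNReal.ofReal ((2:ℝ) ^ (-(α * H) * L) * τ ^ (H - T)) * 1 := by
        rw [ENNReal.tsum_add, ENNReal.tsum_mul_right, ENNReal.tsum_mul_left]
        gcongr
        exact hK L
    _ = ENNReal.ofReal ((K + 1) * ((2:ℝ) ^ (-(α * H) * L) *
          ((L:ℝ) + 1) ^ (e * (1 - H / T)))) := by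
        rw [mul_one, ← ENNReal.ofReal_mul (by positivity),
          ← ENNReal.ofReal_add (by positivity) (by positivity), hτ2, ← hτ1]
        congr 1
        ring
  refine (ENNReal.rpow_le_rpow htotal (by positivity)).trans_eq ?_
  rw [ENNReal.ofReal_rpow_of_nonneg (by positivity) (by positivity),
    Real.mul_rpow (by positivity) (by positivity), Real.mul_rpow (by positivity) (by positivity),
    ← Real.rpow_mul (by norm_num), ← Real.rpow_mul hL1.le]
  congr 4
  · field_simp
  · field_simp

/-! ### The lower bound -/

/-- A box with side lengths `2^{t_i + 1}`. -/
def fejerBox (d : ℕ) (t : Fin d → ℕ) : Finset (Fin d → ℤ) :=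
  Fintype.piFinset fun i => Finset.Ico 0 (2 ^ (t i + 1))

/-- The centre of the dyadic block with index `t + 3`, restricted to positive frequencies. -/
def fejerCenter (d : ℕ) (t : Fin d → ℕ) : Fin d → ℤ := fun i => 3 * 2 ^ (t i + 1)

/-- The Fourier coefficients of the Fejér kernel of order `2^{t_i + 1}`, modulated so that its
spectrum lies in the dyadic block with index `t + 3`. -/
def fejerCoeff (d : ℕ) (t : Fin d → ℕ) (k : Fin d → ℤ) : ℝ :=
  (((fejerBox d t ×ˢ fejerBox d t).filter fun q => q.1 - q.2 + fejerCenter d t = k).card : ℝ) /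
    (fejerBox d t).card

/-- Frequencies on which `fejerCoeff` is bounded from below. -/
def fejerCore (d : ℕ) (t : Fin d → ℕ) : Finset (Fin d → ℤ) :=
  Fintype.piFinset fun i => Finset.Ico (fejerCenter d t i) (fejerCenter d t i + 2 ^ t i)

lemma card_fejerBox (d : ℕ) (t : Fin d → ℕ) : (fejerBox d t).card = 2 ^ (∑ i, t i + d) := by
  have h : ∀ n : ℕ, ((2:ℤ) ^ n).toNat = 2 ^ n := fun n => by
    rw [show (2:ℤ) ^ n = ((2 ^ n : ℕ) : ℤ) by push_cast; rfl, Int.toNat_natCast]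
  simp [fejerBox, Fintype.card_piFinset, h, Finset.prod_pow_eq_pow_sum, Finset.sum_add_distrib]

lemma card_fejerCore (d : ℕ) (t : Fin d → ℕ) : (fejerCore d t).card = 2 ^ (∑ i, t i) := by
  have h : ∀ n : ℕ, ((2:ℤ) ^ n).toNat = 2 ^ n := fun n => by
    rw [show (2:ℤ) ^ n = ((2 ^ n : ℕ) : ℤ) by push_cast; rfl, Int.toNat_natCast]
  simp [fejerCore, Fintype.card_piFinset, h, Finset.prod_pow_eq_pow_sum]

lemma mem_blockF_add_three {n : ℕ} {v : ℤ} (h1 : 4 * 2 ^ n ≤ v) (h2 : v < 8 * 2 ^ n) :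
    v ∈ blockF (n + 3) := by
  have h0 : (0:ℤ) < 2 ^ n := by positivity
  have e2 : (2:ℤ) ^ (n + 2) = 4 * 2 ^ n := by ring
  have e3 : (2:ℤ) ^ (n + 3) = 8 * 2 ^ n := by ring
  simp only [blockF, Finset.mem_filter, Finset.mem_Icc, e3,
    show n + 3 - 1 = n + 2 by omega, e2, abs_of_pos (show 0 < v by omega)]
  omega

lemma blockIndex_of_mem_fejerCore {d : ℕ} {t : Fin d → ℕ} {k : Fin d → ℤ}
    (hk : k ∈ fejerCore d t) : blockIndex d k = fun i => t i + 3 := by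
  rw [← mem_piFinset_blockF, Fintype.mem_piFinset]
  intro i
  have := Fintype.mem_piFinset.1 hk i
  simp only [fejerCenter, Finset.mem_Ico, pow_succ] at this
  exact mem_blockF_add_three (by omega) (by omega)

lemma fejer_maps_to {d : ℕ} {t : Fin d → ℕ} (q : (Fin d → ℤ) × (Fin d → ℤ))
    (hq : q ∈ fejerBox d t ×ˢ fejerBox d t) :
    q.1 - q.2 + fejerCenter d t ∈ Fintype.piFinset fun i => blockF (t i + 3) := by
  rw [Fintype.mem_piFinset]
  intro i
  obtain ⟨h1, h2⟩ := Finset.mem_product.1 hq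
  have h1 := Fintype.mem_piFinset.1 h1 i
  have h2 := Fintype.mem_piFinset.1 h2 i
  simp only [Finset.mem_Ico, pow_succ] at h1 h2
  refine mem_blockF_add_three ?_ ?_ <;>
    simp only [fejerCenter, Pi.add_apply, Pi.sub_apply, pow_succ] <;> omega

lemma le_fejerCoeff {d : ℕ} {t : Fin d → ℕ} {k : Fin d → ℤ} (hk : k ∈ fejerCore d t) :
    (2:ℝ) ^ (-(d:ℝ)) ≤ fejerCoeff d t k := by
  have h : (fejerCore d t).card ≤
      ((fejerBox d t ×ˢ fejerBox d t).filter fun q => q.1 - q.2 + fejerCenter d t = k).card := by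
    refine Finset.card_le_card_of_injOn
      (fun b => (b - fejerCenter d t + (k - fejerCenter d t), b - fejerCenter d t)) ?_ ?_
    · intro b hb
      simp only [Finset.mem_coe, Finset.mem_filter, Finset.mem_product, fejerBox,
        Fintype.mem_piFinset, ← forall_and]
      refine ⟨fun i => ?_, by abel⟩
      have h1 := Fintype.mem_piFinset.1 hb i
      have h2 := Fintype.mem_piFinset.1 hk i
      simp only [Finset.mem_Ico, pow_succ, Pi.add_apply, Pi.sub_apply] at h1 h2 ⊢
      omega
    · intro b _ b' _ hbb
      exact sub_left_injective (Prod.ext_iff.1 hbb).2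
  rw [fejerCoeff, card_fejerBox, le_div_iff₀ (by positivity)]
  rw [card_fejerCore] at h
  refine le_trans (le_of_eq ?_) (Nat.cast_le.2 h)
  push_cast
  rw [pow_add, Real.rpow_neg zero_le_two, Real.rpow_natCast]
  field_simp

lemma fejer_kernel_eq (d : ℕ) (t : Fin d → ℕ) (x : Fin d → ℝ) :
    ∑ k ∈ Fintype.piFinset (fun i => blockF (t i + 3)), (fejerCoeff d t k : ℂ) * expk d k x
      = expk d (fejerCenter d t) x * (‖∑ k ∈ fejerBox d t, 1 * expk d k x‖ ^ 2 : ℝ) /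
        (fejerBox d t).card := by
  have h1 : ((‖∑ k ∈ fejerBox d t, 1 * expk d k x‖ ^ 2 : ℝ) : ℂ)
      = ∑ q ∈ fejerBox d t ×ˢ fejerBox d t, expk d (q.1 - q.2) x := by
    push_cast
    rw [← Complex.mul_conj', map_sum, Finset.sum_mul_sum, ← Finset.sum_product']
    refine Finset.sum_congr rfl fun q _ => ?_
    rw [map_mul, conj_expk, sub_eq_add_neg, expk_add]
    simp
  rw [h1, Finset.mul_sum, Finset.sum_div, ← Finset.sum_fiberwise_of_maps_to fejer_maps_to]
  refine Finset.sum_congr rfl fun k _ => ?_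
  rw [Finset.sum_congr (g := fun _ => expk d k x / (fejerBox d t).card) rfl fun q hq => by
    rw [← (Finset.mem_filter.1 hq).2, add_comm, expk_add]]
  rw [Finset.sum_const, nsmul_eq_mul, fejerCoeff]
  push_cast
  ring

lemma LqNorm_fejer_le (d : ℕ) {p : ℝ≥0∞} (hp1 : 1 ≤ p) (hp : p ≠ ∞) (t : Fin d → ℕ) :
    LqNorm d p (fun x => ∑ k ∈ Fintype.piFinset (fun i => blockF (t i + 3)),
      (fejerCoeff d t k : ℂ) * expk d k x) ≤
      ENNReal.ofReal ((2:ℝ) ^ (((∑ i, t i : ℕ) + d : ℝ) * (1 - 1 / p.toReal))) := by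
  have hP1 : 1 ≤ p.toReal := by simpa using ENNReal.toReal_mono hp hp1
  set P := p.toReal
  set N : ℝ := ((fejerBox d t).card : ℝ) with hN
  have hN2 : N = (2:ℝ) ^ ((∑ i, t i : ℕ) + d : ℝ) := by
    rw [hN, card_fejerBox]
    push_cast
    rw [← Real.rpow_natCast]
    push_cast
    rfl
  have hN0 : 0 < N := by rw [hN2]; positivity
  rw [LqNorm_trigPoly d (one_pos.trans_le hp1).ne' hp]
  refine ENNReal.ofReal_le_ofReal ?_
  set D : (Fin d → ℝ) → ℝ := fun x => ‖∑ k ∈ fejerBox d t, 1 * expk d k x‖ ^ 2 with hD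
  have hnorm : ∀ x, ‖∑ k ∈ Fintype.piFinset (fun i => blockF (t i + 3)),
      (fejerCoeff d t k : ℂ) * expk d k x‖ = D x / N := fun x => by
    rw [fejer_kernel_eq, norm_div, norm_mul, norm_expk, Complex.norm_real, one_mul,
      Complex.norm_natCast, Real.norm_of_nonneg (by positivity)]
  have hDint : Integrable D (volume.restrict (cube d)) := by
    have := (memLp_trigPoly d 2 (fejerBox d t) fun _ => 1).integrable_norm_rpow
      (by simp) (by simp)
    simpa [hD] using this
  have hDN : ∀ x, D x / N ≤ N := fun x => by
    rw [div_le_iff₀ hN0, ← sq]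
    refine pow_le_pow_left₀ (norm_nonneg _) ((norm_trigPoly_le d _ (fun _ => 1) x).trans ?_) 2
    simp [hN]
  have hI : ∫ x in cube d, D x = N := by
    rw [hD, integral_norm_sq_trigPoly d _ (fun _ => 1)]
    simp [hN]
  calc (∫ x in cube d, ‖∑ k ∈ Fintype.piFinset (fun i => blockF (t i + 3)),
        (fejerCoeff d t k : ℂ) * expk d k x‖ ^ P) ^ (1 / P)
      ≤ (∫ x in cube d, N ^ (P - 1) * (D x / N)) ^ (1 / P) := by
        refine Real.rpow_le_rpow (integral_nonneg fun x => by positivity) ?_ (by positivity)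
        refine integral_mono_of_nonneg (ae_of_all _ fun x => by positivity)
          ((hDint.div_const _).const_mul _) (ae_of_all _ fun x => ?_)
        simp only [hnorm]
        have h0 : 0 ≤ D x / N := by positivity
        calc (D x / N) ^ P = (D x / N) ^ (P - 1) * (D x / N) := by
              rw [← Real.rpow_add_one' h0 (by linarith)]
              simp
          _ ≤ _ := by
              gcongr
              exact hDN x
    _ = _ := by
        rw [integral_const_mul, integral_div, hI, div_self hN0.ne', mul_one, hN2,
          ← Real.rpow_mul zero_le_two, ← Real.rpow_mul zero_le_two]
        congr 1
        field_simp

/-- Coefficients of the extremal function: in the dyadic block with index `t + 3` they are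
those of the modulated Fejér kernel. -/
def extremalCoeff (d : ℕ) (c : ℝ) (k : Fin d → ℤ) : ℂ :=
  c * fejerCoeff d (fun i => blockIndex d k i - 3) k

/-- The union of the dyadic blocks with index `t + 3`, `|t|₁ = n`. -/
def extremalSpectrum (d n : ℕ) : Finset (Fin d → ℤ) :=
  (Finset.Nat.antidiagonalTuple d n).biUnion fun t => Fintype.piFinset fun i => blockF (t i + 3)

/-- The union of the cores of the modulated Fejér kernels with index `t`, `|t|₁ = n`. -/
def extremalCore (d n : ℕ) : Finset (Fin d → ℤ) :=
  (Finset.Nat.antidiagonalTuple d n).biUnion fun t => fejerCore d t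

lemma mem_extremalSpectrum {d n : ℕ} {k : Fin d → ℤ} : k ∈ extremalSpectrum d n ↔
    ∃ t ∈ Finset.Nat.antidiagonalTuple d n, blockIndex d k = fun i => t i + 3 := by
  simp only [extremalSpectrum, Finset.mem_biUnion]
  exact exists_congr fun t => and_congr_right fun _ => mem_piFinset_blockF d _ k

lemma card_extremalCore (d n : ℕ) :
    (extremalCore d n).card = (Finset.Nat.antidiagonalTuple d n).card * 2 ^ n := by
  rw [extremalCore, Finset.card_biUnion]
  · rw [Finset.sum_congr rfl fun t ht => by
      rw [card_fejerCore, (sum_eq_iff_mem_antidiagonalTuple _ _ _).1 ht]]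
    simp
  · intro t _ u _ htu
    refine Finset.disjoint_left.2 fun k hk hk' => htu ?_
    have h := (blockIndex_of_mem_fejerCore hk).symm.trans (blockIndex_of_mem_fejerCore hk')
    exact funext fun i => by simpa using congrFun h i

lemma extremal_of_mem_core {d n : ℕ} {c : ℝ} (hc : 0 ≤ c) {k : Fin d → ℤ}
    (hk : k ∈ extremalCore d n) :
    k ∈ extremalSpectrum d n ∧ c * (2:ℝ) ^ (-(d:ℝ)) ≤ ‖extremalCoeff d c k‖ := by
  obtain ⟨t, ht, hkt⟩ := Finset.mem_biUnion.1 hk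
  have hb := blockIndex_of_mem_fejerCore hkt
  refine ⟨mem_extremalSpectrum.2 ⟨t, ht, hb⟩, ?_⟩
  rw [extremalCoeff, hb, ← Complex.ofReal_mul, Complex.norm_real]
  exact (mul_le_mul_of_nonneg_left (le_fejerCoeff hkt) hc).trans (le_abs_self _)

lemma blockProj_extremal (d n : ℕ) (c : ℝ) {t : Fin d → ℕ}
    (ht : t ∈ Finset.Nat.antidiagonalTuple d n) :
    blockProj d (fun x => ∑ k ∈ extremalSpectrum d n, extremalCoeff d c k * expk d k x)
      (fun i => t i + 3) = (c : ℂ) • fun x =>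
        ∑ k ∈ Fintype.piFinset (fun i => blockF (t i + 3)), (fejerCoeff d t k : ℂ) * expk d k x := by
  ext x
  simp only [blockProj, Pi.smul_apply, smul_eq_mul, Finset.mul_sum]
  refine Finset.sum_congr rfl fun k hk => ?_
  have hb := (mem_piFinset_blockF d _ k).1 hk
  rw [fCoeff_trigPoly, if_pos (mem_extremalSpectrum.2 ⟨t, ht, hb⟩), extremalCoeff, hb]
  simp [mul_assoc]

lemma blockProj_extremal_eq_zero (d n : ℕ) (c : ℝ) {j : Fin d → ℕ}
    (hj : ∀ t ∈ Finset.Nat.antidiagonalTuple d n, j ≠ fun i => t i + 3) :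
    blockProj d (fun x => ∑ k ∈ extremalSpectrum d n, extremalCoeff d c k * expk d k x) j = 0 := by
  ext x
  simp only [blockProj, Pi.zero_apply]
  refine Finset.sum_eq_zero fun k hk => ?_
  have hb := (mem_piFinset_blockF d _ k).1 hk
  rw [fCoeff_trigPoly, if_neg, zero_mul]
  intro hk'
  obtain ⟨t, ht, hbt⟩ := mem_extremalSpectrum.1 hk'
  exact hj t ht (hb.symm.trans hbt)

lemma besovNorm_extremal_le (d n : ℕ) {p θ : ℝ≥0∞} (hp1 : 1 ≤ p) (hp : p ≠ ∞) (hθ0 : θ ≠ 0)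
    (hθ : θ ≠ ∞) (r : ℝ) {c : ℝ} (hc : 0 ≤ c)
    (hc1 : ((Finset.Nat.antidiagonalTuple d n).card : ℝ) ^ (1 / θ.toReal) *
      (2 ^ ((n + d * 3 : ℝ) * r) * (c * 2 ^ ((n + d : ℝ) * (1 - 1 / p.toReal)))) ≤ 1) :
    besovNorm d r p θ
      (fun x => ∑ k ∈ extremalSpectrum d n, extremalCoeff d c k * expk d k x) ≤ 1 := by
  have hT : 0 < θ.toReal := ENNReal.toReal_pos hθ0 hθ
  set f : (Fin d → ℝ) → ℂ :=
    fun x => ∑ k ∈ extremalSpectrum d n, extremalCoeff d c k * expk d k x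
  have hshift : Function.Injective fun (t : Fin d → ℕ) (i : Fin d) => t i + 3 :=
    fun t u h => funext fun i => by simpa using congrFun h i
  rw [besovNorm, if_neg hθ, tsum_eq_sum
    (s := (Finset.Nat.antidiagonalTuple d n).image fun t i => t i + 3) fun j hj => ?_,
    Finset.sum_image fun t _ u _ h => hshift h]
  · have hterm : ∀ t ∈ Finset.Nat.antidiagonalTuple d n,
        (ENNReal.ofReal ((2:ℝ) ^ (((∑ i, (t i + 3) : ℕ) : ℝ) * r)) *
          LqNorm d p (blockProj d f fun i => t i + 3)) ^ θ.toReal ≤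
        (ENNReal.ofReal (2 ^ ((n + d * 3 : ℝ) * r) *
          (c * 2 ^ ((n + d : ℝ) * (1 - 1 / p.toReal))))) ^ θ.toReal := fun t ht => by
      have hn := (sum_eq_iff_mem_antidiagonalTuple _ _ _).1 ht
      refine ENNReal.rpow_le_rpow ?_ hT.le
      rw [blockProj_extremal d n c ht, ENNReal.ofReal_mul (by positivity),
        ENNReal.ofReal_mul hc, LqNorm, eLpNorm_const_smul]
      refine mul_le_mul' (le_of_eq ?_) (mul_le_mul' (le_of_eq ?_) ?_)
      · rw [Finset.sum_add_distrib, hn]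
        simp
      · rw [← ofReal_norm, Complex.norm_real, Real.norm_of_nonneg hc]
      · have := LqNorm_fejer_le d hp1 hp t
        rwa [hn] at this
    refine (ENNReal.rpow_le_rpow (Finset.sum_le_sum hterm) (by positivity)).trans ?_
    rw [Finset.sum_const, nsmul_eq_mul, ENNReal.mul_rpow_of_nonneg _ _ (by positivity),
      ← ENNReal.rpow_mul, mul_one_div_cancel hT.ne', ENNReal.rpow_one, ← ENNReal.ofReal_natCast,
      ENNReal.ofReal_rpow_of_nonneg (by positivity) (by positivity),
      ← ENNReal.ofReal_mul (by positivity)]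
    exact ENNReal.ofReal_le_one.2 hc1
  · rw [blockProj_extremal_eq_zero d n c fun t ht h =>
      hj (Finset.mem_image.2 ⟨t, ht, h.symm⟩)]
    simp [LqNorm, hT]

lemma le_sigmaF_extremal (d n m : ℕ) {η : ℝ≥0∞} (hη0 : η ≠ 0) (hη : η ≠ ∞) {c : ℝ} (hc : 0 ≤ c)
    (hm : 2 * m ≤ (Finset.Nat.antidiagonalTuple d n).card * 2 ^ n) :
    ENNReal.ofReal ((((Finset.Nat.antidiagonalTuple d n).card : ℝ) * 2 ^ n / 2) ^ (1 / η.toReal) *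
      (c * 2 ^ (-(d:ℝ)))) ≤ sigmaF d m (wienerNorm d 0 η)
      (fun x => ∑ k ∈ extremalSpectrum d n, extremalCoeff d c k * expk d k x) := by
  have hH : 0 < η.toReal := ENNReal.toReal_pos hη0 hη
  rw [sigmaF]
  refine le_iInf₂ fun s hs => ?_
  obtain ⟨Λ, b, hΛ, rfl⟩ := hs
  rw [wienerNorm_zero _ hη]
  set f : (Fin d → ℝ) → ℂ :=
    fun x => ∑ k ∈ extremalSpectrum d n, extremalCoeff d c k * expk d k x
  set s : (Fin d → ℝ) → ℂ := fun x => ∑ k ∈ Λ, b k * expk d k x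
  have hterm : ∀ k ∈ extremalCore d n \ Λ, ENNReal.ofReal ((c * 2 ^ (-(d:ℝ))) ^ η.toReal) ≤
      (‖fCoeff d (f - s) k‖₊ : ℝ≥0∞) ^ η.toReal := fun k hk => by
    obtain ⟨hk1, hk2⟩ := Finset.mem_sdiff.1 hk
    obtain ⟨h1, h2⟩ := extremal_of_mem_core hc hk1
    rw [fCoeff_sub _ (integrable_trigPoly _ _ _) (integrable_trigPoly _ _ _),
      fCoeff_trigPoly, fCoeff_trigPoly, if_pos h1, if_neg hk2, sub_zero,
      ← ENNReal.ofReal_rpow_of_nonneg (by positivity) hH.le, ← enorm_eq_nnnorm, ← ofReal_norm]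
    exact ENNReal.rpow_le_rpow (ENNReal.ofReal_le_ofReal h2) hH.le
  have hcard : ((Finset.Nat.antidiagonalTuple d n).card : ℝ) * 2 ^ n / 2 ≤
      (extremalCore d n \ Λ).card := by
    have h1 := Finset.le_card_sdiff Λ (extremalCore d n)
    rw [card_extremalCore] at h1
    have h2 : (Finset.Nat.antidiagonalTuple d n).card * 2 ^ n ≤
      2 * (extremalCore d n \ Λ).card := by omega
    have h3 : (((Finset.Nat.antidiagonalTuple d n).card * 2 ^ n : ℕ) : ℝ) ≤
      ((2 * (extremalCore d n \ Λ).card : ℕ) : ℝ) := Nat.cast_le.2 h2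
    push_cast at h3
    linarith
  calc _ = (ENNReal.ofReal (((Finset.Nat.antidiagonalTuple d n).card : ℝ) * 2 ^ n / 2) *
        ENNReal.ofReal ((c * 2 ^ (-(d:ℝ))) ^ η.toReal)) ^ (1 / η.toReal) := by
        rw [← ENNReal.ofReal_mul (by positivity),
          ENNReal.ofReal_rpow_of_nonneg (by positivity) (by positivity),
          Real.mul_rpow (by positivity) (by positivity), ← Real.rpow_mul (by positivity),
          mul_one_div_cancel hH.ne', Real.rpow_one]
    _ ≤ (∑ k ∈ extremalCore d n \ Λ,
          (‖fCoeff d (f - s) k‖₊ : ℝ≥0∞) ^ η.toReal) ^ (1 / η.toReal) := by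
        refine ENNReal.rpow_le_rpow ?_ (by positivity)
        refine le_trans ?_ (Finset.card_nsmul_le_sum _ _ _ hterm)
        rw [nsmul_eq_mul, ← ENNReal.ofReal_natCast]
        gcongr
    _ ≤ _ := ENNReal.rpow_le_rpow (ENNReal.sum_le_tsum _) (by positivity)

lemma exists_le_sigmaClass (e : ℕ) {p θ η : ℝ≥0∞} (hp1 : 1 ≤ p) (hp : p ≠ ∞)
    (hη : 0 < η) (hηθ : η ≤ θ) (hθ : θ ≠ ∞) {r α : ℝ}
    (hα : α = r + 1 - 1 / p.toReal - 1 / η.toReal) :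
    ∃ c : ℝ, 0 < c ∧ ∀ n m : ℕ,
      2 * m ≤ (Finset.Nat.antidiagonalTuple (e + 1) n).card * 2 ^ n →
      ENNReal.ofReal (c * ((2:ℝ) ^ (-α * n) *
          ((n:ℝ) + 1) ^ (e * (1 / η.toReal - 1 / θ.toReal)))) ≤
        sigmaClass (e + 1) m (besovNorm (e + 1) r p θ) (wienerNorm (e + 1) 0 η) := by
  have hηt : η ≠ ∞ := ne_top_of_le_ne_top hθ hηθ
  have hH : 0 < η.toReal := ENNReal.toReal_pos hη.ne' hηt
  have hHT : η.toReal ≤ θ.toReal := ENNReal.toReal_mono hθ hηθ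
  have hT : 0 < θ.toReal := hH.trans_le hHT
  set H := η.toReal with hHdef
  set T := θ.toReal with hTdef
  set P := p.toReal with hPdef
  set d := e + 1
  have hδ : 0 ≤ 1 / H - 1 / T := sub_nonneg.2 (one_div_le_one_div_of_le hH hHT)
  refine ⟨(((e:ℝ) + 1) ^ e)⁻¹ ^ (1 / H - 1 / T) * (2:ℝ) ^ (-(1 / H)) * (2:ℝ) ^ (-(d:ℝ)) *
    (2:ℝ) ^ (-(d * 3 * r) - d * (1 - 1 / P)), by positivity, fun n m hm => ?_⟩
  set Q : ℝ := ((Finset.Nat.antidiagonalTuple d n).card : ℝ) with hQ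
  have hQle : (((e:ℝ) + 1) ^ e)⁻¹ * ((n:ℝ) + 1) ^ e ≤ Q := by
    rw [inv_mul_le_iff₀ (by positivity), hQ]
    exact_mod_cast le_card_antidiagonalTuple e n
  have hQ0 : 0 < Q := lt_of_lt_of_le (by positivity) hQle
  set c : ℝ := Q ^ (-(1 / T)) * (2 ^ (-((n + d * 3 : ℝ) * r)) * 2 ^ (-((n + d : ℝ) * (1 - 1 / P))))
    with hc
  have hc0 : 0 ≤ c := by positivity
  have hbesov := besovNorm_extremal_le d n hp1 hp (hη.trans_le hηθ).ne' hθ r hc0 (by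
    rw [← hQ, ← hTdef, ← hPdef, hc, Real.rpow_neg hQ0.le, Real.rpow_neg zero_le_two,
      Real.rpow_neg zero_le_two]
    refine le_of_eq ?_
    field_simp)
  rw [sigmaClass]
  refine le_trans ?_ (le_iSup₂_of_le _ ⟨integrable_trigPoly _ _ _, hbesov⟩
    (le_sigmaF_extremal d n m hη.ne' hηt hc0 hm))
  rw [← hQ, ← hHdef]
  refine ENNReal.ofReal_le_ofReal ?_
  have hrhs : (Q * 2 ^ n / 2) ^ (1 / H) * (c * 2 ^ (-(d:ℝ))) =
      Q ^ (1 / H - 1 / T) * ((2:ℝ) ^ (-(1 / H)) * (2:ℝ) ^ (-(d:ℝ)) *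
      (2:ℝ) ^ (-(d * 3 * r) - d * (1 - 1 / P)) * (2:ℝ) ^ (-α * n)) := by
    have h2 : (Q * 2 ^ n / 2) = Q * (2:ℝ) ^ ((n:ℝ) - 1) := by
      rw [Real.rpow_sub_one two_ne_zero, Real.rpow_natCast]
      ring
    rw [h2, Real.mul_rpow hQ0.le (by positivity), ← Real.rpow_mul zero_le_two, hc,
      show 1 / H - 1 / T = 1 / H + -(1 / T) by ring, Real.rpow_add hQ0]
    have h3 : ∀ a b b' c' u v w z : ℝ, a + b + b' + c' = u + v + w + z →
        (2:ℝ) ^ a * 2 ^ b * 2 ^ b' * 2 ^ c' = 2 ^ u * 2 ^ v * 2 ^ w * 2 ^ z := by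
      intro a b b' c' u v w z h
      simp only [← Real.rpow_add two_pos, h]
    rw [← h3 (((n:ℝ) - 1) * (1 / H)) (-((n + d * 3 : ℝ) * r)) (-((n + d : ℝ) * (1 - 1 / P)))
      (-(d:ℝ)) _ _ _ _ (by rw [hα]; ring)]
    ring
  rw [hrhs]
  have h5 : ((n:ℝ) + 1) ^ ((e:ℝ) * (1 / H - 1 / T)) = (((n:ℝ) + 1) ^ e) ^ (1 / H - 1 / T) := by
    rw [Real.rpow_mul (by positivity), Real.rpow_natCast]
  calc _ = ((((e:ℝ) + 1) ^ e)⁻¹ * ((n:ℝ) + 1) ^ e) ^ (1 / H - 1 / T) *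
      ((2:ℝ) ^ (-(1 / H)) * (2:ℝ) ^ (-(d:ℝ)) *
      (2:ℝ) ^ (-(d * 3 * r) - d * (1 - 1 / P)) * (2:ℝ) ^ (-α * n)) := by
        rw [Real.mul_rpow (by positivity) (by positivity), h5]
        generalize (((n:ℝ) + 1) ^ e) ^ (1 / H - 1 / T) = A
        generalize ((((e:ℝ) + 1) ^ e)⁻¹) ^ (1 / H - 1 / T) = B
        ring
    _ ≤ _ := by gcongr

/-! ### The level of the hyperbolic cross belonging to `m` terms -/

lemma logStar_mem_Icc {e L m : ℕ} (h1 : 2 ^ (L + 1) * (L + 1) ^ e ≤ m)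
    (h2 : m ≤ 2 ^ (e + 2) * (2 ^ L * (L + 1) ^ e)) :
    logStar m ∈ Set.Icc ((L:ℝ) + 1) ((e + 2) * ((L:ℝ) + 1)) := by
  have hpow : 2 ^ (L + 1) ≤ m := (Nat.le_mul_of_pos_right _ (by positivity)).trans h1
  have hm : (0:ℝ) < m := by exact_mod_cast (Nat.pos_of_ne_zero (by positivity)).trans_le hpow
  constructor
  · refine le_max_of_le_left ?_
    rw [Real.le_logb_iff_rpow_le one_lt_two hm]
    exact_mod_cast hpow
  · have hL : (0:ℝ) ≤ L := Nat.cast_nonneg L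
    have he : (0:ℝ) ≤ e := Nat.cast_nonneg e
    refine max_le ?_ (by nlinarith [mul_nonneg he hL])
    rw [Real.logb_le_iff_le_rpow one_lt_two hm]
    have h3 : m ≤ 2 ^ ((e + 2) * (L + 1)) := calc
      m ≤ 2 ^ (e + 2) * (2 ^ L * (L + 1) ^ e) := h2
      _ ≤ 2 ^ (e + 2) * (2 ^ L * (2 ^ L) ^ e) := by
        gcongr
        exact Nat.lt_two_pow_self
      _ = 2 ^ (e + 2 + L + L * e) := by
        rw [← pow_mul]
        ring
      _ ≤ _ := Nat.pow_le_pow_right two_pos (by nlinarith)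
    exact_mod_cast h3

lemma exists_dyadic_level (e : ℕ) {m : ℕ} (hm : 2 ≤ m) : ∃ L : ℕ,
    2 ^ (L + 1) * (L + 1) ^ e ≤ m ∧ m ≤ 2 ^ (e + 2) * (2 ^ L * (L + 1) ^ e) := by
  set L := Nat.findGreatest (fun L => 2 ^ (L + 1) * (L + 1) ^ e ≤ m) m
  refine ⟨L, Nat.findGreatest_spec (P := fun L => 2 ^ (L + 1) * (L + 1) ^ e ≤ m)
    (Nat.zero_le m) (by simpa using hm), ?_⟩
  have hnext : m ≤ 2 ^ (L + 1 + 1) * (L + 1 + 1) ^ e := by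
    by_contra! h
    have hLm : L + 1 ≤ m := by
      calc L + 1 ≤ 2 ^ (L + 1 + 1) := by
            have := Nat.lt_two_pow_self (n := L + 1 + 1)
            omega
        _ ≤ 2 ^ (L + 1 + 1) * (L + 1 + 1) ^ e := Nat.le_mul_of_pos_right _ (by positivity)
        _ ≤ m := h.le
    have := Nat.le_findGreatest (P := fun L => 2 ^ (L + 1) * (L + 1) ^ e ≤ m) hLm h.le
    omega
  calc m ≤ 2 ^ (L + 1 + 1) * (L + 1 + 1) ^ e := hnext
    _ ≤ 2 ^ (L + 1 + 1) * (2 * (L + 1)) ^ e := by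
        gcongr
        omega
    _ = _ := by
        rw [mul_pow]
        ring

lemma le_card_mul_two_pow (e L : ℕ) :
    2 * (2 ^ (e + 2) * (2 ^ L * (L + 1) ^ e)) ≤
      (Finset.Nat.antidiagonalTuple (e + 1) (L + (e + 3 + (e + 1) * e))).card *
        2 ^ (L + (e + 3 + (e + 1) * e)) := by
  set n := L + (e + 3 + (e + 1) * e) with hn
  have h1 : (e + 1) ^ e ≤ 2 ^ ((e + 1) * e) := by
    rw [pow_mul]
    exact Nat.pow_le_pow_left Nat.lt_two_pow_self.le e
  have h2 : (L + 1) ^ e ≤ 2 ^ ((e + 1) * e) * (Finset.Nat.antidiagonalTuple (e + 1) n).card :=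
    (Nat.pow_le_pow_left (by omega) e).trans
      ((le_card_antidiagonalTuple e n).trans (Nat.mul_le_mul_right _ h1))
  calc 2 * (2 ^ (e + 2) * (2 ^ L * (L + 1) ^ e))
      ≤ 2 * (2 ^ (e + 2) * (2 ^ L * (2 ^ ((e + 1) * e) *
          (Finset.Nat.antidiagonalTuple (e + 1) n).card))) := by gcongr
    _ = _ := by
        rw [hn]
        ring

lemma exists_level (e : ℕ) {α δ : ℝ} (hα : 0 < α) (hδ : 0 ≤ δ) :
    ∃ (s : ℕ) (c C : ℝ), 0 < c ∧ 0 < C ∧ ∀ m : ℕ, 2 ≤ m → ∃ L : ℕ,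
      2 ^ (L + 1) * (L + 1) ^ e ≤ m ∧
      2 * m ≤ (Finset.Nat.antidiagonalTuple (e + 1) (L + s)).card * 2 ^ (L + s) ∧
      c * ((m:ℝ) ^ (-α) * logStar m ^ (e * (α + δ))) ≤
        (2:ℝ) ^ (-α * (L + s : ℕ)) * (((L + s : ℕ) : ℝ) + 1) ^ (e * δ) ∧
      (2:ℝ) ^ (-α * L) * ((L:ℝ) + 1) ^ (e * δ) ≤
        C * ((m:ℝ) ^ (-α) * logStar m ^ (e * (α + δ))) := by
  set s := e + 3 + (e + 1) * e
  have he : (0:ℝ) ≤ e := Nat.cast_nonneg e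
  have hγ : 0 ≤ e * (α + δ) := by positivity
  refine ⟨s, ((e + 2 : ℝ) ^ (e * (α + δ)))⁻¹ * 2 ^ (-α * s), ((2:ℝ) ^ (e + 2)) ^ α,
    by positivity, by positivity, fun m hm => ?_⟩
  obtain ⟨L, h1, h2⟩ := exists_dyadic_level e hm
  obtain ⟨hl1, hl2⟩ := logStar_mem_Icc h1 h2
  have hL : (0:ℝ) < (L:ℝ) + 1 := by positivity
  have hm0 : (0:ℝ) < m := by exact_mod_cast two_pos.trans_le hm
  set x : ℝ := 2 ^ L * ((L:ℝ) + 1) ^ e with hx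
  have hx0 : 0 < x := by positivity
  have hmx1 : x ≤ m := by
    have h : ((2 ^ (L + 1) * (L + 1) ^ e : ℕ) : ℝ) ≤ m := Nat.cast_le.2 h1
    push_cast at h
    rw [pow_succ] at h
    nlinarith
  have hmx2 : (m:ℝ) ≤ 2 ^ (e + 2) * x := by
    rw [hx]
    exact_mod_cast h2
  have hE : x ^ (-α) * ((L:ℝ) + 1) ^ (e * (α + δ)) = 2 ^ (-α * L) * ((L:ℝ) + 1) ^ (e * δ) := by
    rw [hx, Real.mul_rpow (by positivity) (by positivity), ← Real.rpow_natCast,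
      ← Real.rpow_natCast, ← Real.rpow_mul zero_le_two, ← Real.rpow_mul hL.le, mul_assoc,
      ← Real.rpow_add hL]
    congr 2 <;> ring
  refine ⟨L, h1, (Nat.mul_le_mul_left 2 h2).trans (le_card_mul_two_pow e L), ?_, ?_⟩
  · calc ((e + 2 : ℝ) ^ (e * (α + δ)))⁻¹ * 2 ^ (-α * s) *
          ((m:ℝ) ^ (-α) * logStar m ^ (e * (α + δ)))
        ≤ ((e + 2 : ℝ) ^ (e * (α + δ)))⁻¹ * 2 ^ (-α * s) *
          (x ^ (-α) * ((e + 2) * ((L:ℝ) + 1)) ^ (e * (α + δ))) := by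
          have h3 : (m:ℝ) ^ (-α) ≤ x ^ (-α) :=
            Real.rpow_le_rpow_of_nonpos hx0 hmx1 (by linarith)
          have h4 : logStar m ^ (e * (α + δ)) ≤ ((e + 2) * ((L:ℝ) + 1)) ^ (e * (α + δ)) :=
            Real.rpow_le_rpow (hL.le.trans hl1) hl2 hγ
          have h5 : 0 ≤ logStar m ^ (e * (α + δ)) := Real.rpow_nonneg (hL.le.trans hl1) _
          gcongr
      _ = 2 ^ (-α * s) * (x ^ (-α) * ((L:ℝ) + 1) ^ (e * (α + δ))) := by
          rw [Real.mul_rpow (by positivity) hL.le]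
          field_simp
      _ = 2 ^ (-α * (L + s : ℕ)) * ((L:ℝ) + 1) ^ (e * δ) := by
          rw [hE, ← mul_assoc, ← Real.rpow_add two_pos]
          congr 2
          push_cast
          ring
      _ ≤ _ := by
          gcongr
          omega
  · rw [← hE]
    have h3 : x ^ (-α) ≤ ((2:ℝ) ^ (e + 2)) ^ α * (m:ℝ) ^ (-α) := by
      have := Real.rpow_le_rpow_of_nonpos hm0 hmx2 (by linarith : -α ≤ 0)
      rw [Real.mul_rpow (by positivity) hx0.le, Real.rpow_neg (by positivity)] at this
      rwa [inv_mul_le_iff₀ (by positivity)] at this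
    have h4 : ((L:ℝ) + 1) ^ (e * (α + δ)) ≤ logStar m ^ (e * (α + δ)) :=
      Real.rpow_le_rpow hL.le hl1 hγ
    rw [← mul_assoc]
    gcongr

/-- `σ_m(S^r_{p,θ}B)_{A_η}` for `1 < p ≤ 2`, `0 < η ≤ θ ≤ 2`
and `r > 1/p + 1/η - 1`. -/
theorem statement17 (d : ℕ) (hd : 1 ≤ d) (p θ η : ℝ≥0∞) (hp1 : 1 < p) (hp2 : p ≤ 2)
    (hη : 0 < η) (hηθ : η ≤ θ) (hθ2 : θ ≤ 2) (r : ℝ)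
    (hr : 1/p.toReal + 1/η.toReal - 1 < r) :
    IsAsympEquiv (fun m => sigmaClass d m (besovNorm d r p θ) (wienerNorm d 0 η))
      (fun m => (m : ℝ) ^ (-(r + 1 - 1/p.toReal - 1/η.toReal)) *
        logStar m ^ (((d : ℝ) - 1) * (r + 1 - 1/p.toReal - 1/θ.toReal))) := by
  obtain ⟨e, rfl⟩ : ∃ e, d = e + 1 := ⟨d - 1, by omega⟩
  have hθt : θ ≠ ∞ := ne_top_of_le_ne_top (by simp) hθ2
  have hpt : p ≠ ∞ := ne_top_of_le_ne_top (by simp) hp2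
  have hηt : η ≠ ∞ := ne_top_of_le_ne_top hθt hηθ
  have hH : 0 < η.toReal := ENNReal.toReal_pos hη.ne' hηt
  have hδ : 0 ≤ 1 / η.toReal - 1 / θ.toReal :=
    sub_nonneg.2 (one_div_le_one_div_of_le hH (ENNReal.toReal_mono hθt hηθ))
  obtain ⟨α, hα⟩ : ∃ α, α = r + 1 - 1 / p.toReal - 1 / η.toReal := ⟨_, rfl⟩
  have hα0 : 0 < α := by linarith
  obtain ⟨C₁, hC₁, hup⟩ :=
    exists_sigmaClass_le e (one_pos.trans hp1).ne' hp2 hη hηθ hθ2 hα hα0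
  obtain ⟨c₁, hc₁, hlow⟩ := exists_le_sigmaClass e hp1.le hpt hη hηθ hθt hα
  obtain ⟨s, c₂, C₂, hc₂, hC₂, hlevel⟩ := exists_level e hα0 hδ
  refine ⟨c₁ * c₂, C₁ * C₂, by positivity, by positivity, 2, fun m hm => ?_⟩
  have hrate : (m : ℝ) ^ (-(r + 1 - 1 / p.toReal - 1 / η.toReal)) *
      logStar m ^ ((((e + 1 : ℕ) : ℝ) - 1) * (r + 1 - 1 / p.toReal - 1 / θ.toReal)) =
      (m : ℝ) ^ (-α) * logStar m ^ (e * (α + (1 / η.toReal - 1 / θ.toReal))) := by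
    rw [hα]
    push_cast
    congr 2
    ring
  dsimp only
  rw [hrate]
  obtain ⟨L, h1, h2, h3, h4⟩ := hlevel m hm
  constructor
  · refine le_trans (ENNReal.ofReal_le_ofReal ?_) (hlow _ m h2)
    rw [mul_assoc]
    exact mul_le_mul_of_nonneg_left h3 hc₁.le
  · refine (hup L m h1).trans (ENNReal.ofReal_le_ofReal ?_)
    rw [mul_assoc]
    exact mul_le_mul_of_nonneg_left h4 hC₁.le

end Paper
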